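/- arXiv:2411.03889 — 2 statements merged into one kernel-verified Lean document; each statement's English description precedes it below -/
import Mathlib

section
/- Let F be a field equipped with a discrete valuation ν : Fˣ → ℤ and let k ≥ 1. Then the k-th exterior power ⋀^k(Fˣ) (over ℤ, with Fˣ written additively) is generated as a ℤ-module by the elements a₁ ∧ … ∧ a_k for which ν(a₂) = … = ν(a_k) = 0. -/
/-- A discrete valuation on a field `F`: a surjective group homomorphism `ν : Fˣ → ℤ`
(written multiplicatively on the source) such that `ν (a + b) ≥ min (ν a) (ν b)`
whenever `a`, `b` and `a + b` are all nonzero. -/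
def IsDiscreteValuation {F : Type*} [Field F] (ν : Fˣ → ℤ) : Prop :=
  Function.Surjective ν ∧ (∀ a b : Fˣ, ν (a * b) = ν a + ν b) ∧
    ∀ (a b : Fˣ) (h : (a : F) + (b : F) ≠ 0),
      min (ν a) (ν b) ≤ ν (Units.mk0 ((a : F) + (b : F)) h)

/-- `a₁ ∧ ⋯ ∧ aₙ` as an element of the `n`-th exterior power `⋀[R]^n M`. -/
noncomputable def wedge (R : Type*) {M : Type*} [CommRing R] [AddCommGroup M] [Module R M]
    (n : ℕ) (a : Fin n → M) : ⋀[R]^n M :=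
  ⟨ExteriorAlgebra.ιMulti R n a, ExteriorAlgebra.ιMulti_range R n ⟨a, rfl⟩⟩

/-- If `p` together with `s` spans `M`, then `⋀[R]^(n + 1) M` is spanned by the wedges all of
whose entries after the first one lie in `s`. -/
theorem span_wedge_eq_top_of_span_insert {R M : Type*} [CommRing R] [AddCommGroup M] [Module R M]
    {p : M} {s : Set M} (hs : Submodule.span R (insert p s) = ⊤) (n : ℕ) :
    Submodule.span R {x : ⋀[R]^(n + 1) M |
      ∃ a : Fin (n + 1) → M, (∀ i, i ≠ 0 → a i ∈ s) ∧ x = wedge R (n + 1) a} = ⊤ := by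
  rw [eq_top_iff, ← exteriorPower.ιMulti_span_of_span R (n + 1) M hs, Submodule.span_le]
  rintro _ ⟨v, hv, rfl⟩
  replace hv : ∀ i, v i = p ∨ v i ∈ s := fun i => hv ⟨i, rfl⟩
  by_cases hp : ∃ i, v i = p
  · obtain ⟨i, hi⟩ := hp
    by_cases hinj : Function.Injective v
    · have hswap : exteriorPower.ιMulti R (n + 1) (v ∘ Equiv.swap 0 i) ∈
          Submodule.span R {x : ⋀[R]^(n + 1) M |
            ∃ a : Fin (n + 1) → M, (∀ i, i ≠ 0 → a i ∈ s) ∧ x = wedge R (n + 1) a} := by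
        refine Submodule.subset_span ⟨_, fun j hj => (hv _).resolve_left fun h => hj ?_, rfl⟩
        have := hinj (h.trans hi.symm)
        rwa [Equiv.swap_apply_eq_iff, Equiv.swap_apply_right] at this
      rw [AlternatingMap.map_perm] at hswap
      rcases Int.units_eq_one_or (Equiv.Perm.sign (Equiv.swap 0 i)) with h | h <;>
        simpa [h] using hswap
    · rw [(exteriorPower.ιMulti R (n + 1)).map_eq_zero_of_not_injective v hinj]
      exact zero_mem _
  · push Not at hp
    exact Submodule.subset_span ⟨v, fun i _ => (hv i).resolve_left (hp i), rfl⟩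

/-- A uniformizer and the units of valuation zero generate the multiplicative group. -/
theorem IsDiscreteValuation.exists_span_insert_eq_top {F : Type*} [Field F] {ν : Fˣ → ℤ}
    (hν : IsDiscreteValuation ν) :
    ∃ p : Additive Fˣ,
      Submodule.span ℤ (insert p {x : Additive Fˣ | ν x.toMul = 0}) = ⊤ := by
  obtain ⟨hsurj, hmul, -⟩ := hν
  obtain ⟨p, hp⟩ := hsurj 1
  let f : Additive Fˣ →+ ℤ := AddMonoidHom.mk' (fun x => ν x.toMul) fun x y => hmul _ _
  refine ⟨Additive.ofMul p, eq_top_iff.2 fun x _ => ?_⟩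
  have hx : f (x - f x • Additive.ofMul p) = 0 := by
    have hfp : f (Additive.ofMul p) = 1 := hp
    simp [hfp]
  rw [← sub_add_cancel x (f x • Additive.ofMul p)]
  exact add_mem (Submodule.subset_span (Set.mem_insert_of_mem _ hx))
    (Submodule.smul_mem _ _ (Submodule.subset_span (Set.mem_insert _ _)))

/-- For a field `F` with a discrete valuation `ν` and `k = n + 1 ≥ 1`, the exterior power
`⋀^k (Fˣ)` (over `ℤ`, with `Fˣ` written additively) is generated as a `ℤ`-module by the
elements `a₁ ∧ ⋯ ∧ a_k` with `ν a₂ = ⋯ = ν a_k = 0`. -/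
theorem exteriorPower_units_span {F : Type*} [Field F] (ν : Fˣ → ℤ)
    (hν : IsDiscreteValuation ν) (n : ℕ) :
    Submodule.span ℤ {x : ⋀[ℤ]^(n + 1) (Additive Fˣ) |
      ∃ a : Fin (n + 1) → Fˣ, (∀ i, i ≠ 0 → ν (a i) = 0) ∧
        x = wedge ℤ (n + 1) (fun i => Additive.ofMul (a i))} = ⊤ := by
  obtain ⟨p, hp⟩ := hν.exists_span_insert_eq_top
  rw [eq_top_iff, ← span_wedge_eq_top_of_span_insert hp n]
  refine Submodule.span_mono ?_
  rintro _ ⟨a, ha, rfl⟩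
  exact ⟨fun i => (a i).toMul, ha, rfl⟩
end

section
/- Let K be an algebraically closed field of characteristic zero and let f, g be nonzero elements of the field K(t) of rational functions over K. For a ∈ K, let m_a(f) ∈ ℤ denote the order of vanishing of f at a (the exponent of (t-a) in the factorization of f), and set m_∞(f) = -(deg of numerator of f - deg of denominator of f). For each a ∈ K, the rational function (-1)^{m_a(f)·m_a(g)} · f^{m_a(g)} · g^{-m_a(f)} has order 0 at a, and its value T_a(f,g) at t = a is a well-defined nonzero element of K; similarly (-1)^{m_∞(f)·m_∞(g)} · f^{m_∞(g)} · g^{-m_∞(f)} has m_∞ equal to 0, and T_∞(f,g) denotes the ratio of the leading coefficient of its numerator to the leading coefficient of its denominator, a nonzero element of K. Then T_a(f,g) = 1 for all but finitely many a ∈ K, and the product of T_∞(f,g) with the product of T_a(f,g) over all a ∈ K with T_a(f,g) ≠ 1 equals 1. -/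
/-- The order of vanishing of a nonzero rational function `f` at a point `a`: the exponent
of `(t - a)` in the factorization of `f`, i.e. the multiplicity of `a` as a root of the
numerator minus its multiplicity as a root of the denominator. -/
noncomputable def ordAt {K : Type*} [Field K] (a : K) (f : RatFunc K) : ℤ :=
  (f.num.rootMultiplicity a : ℤ) - (f.denom.rootMultiplicity a : ℤ)

/-- The order of vanishing of a rational function at infinity:
`-(deg numerator - deg denominator)`. -/
noncomputable def ordInf {K : Type*} [Field K] (f : RatFunc K) : ℤ :=
  -f.intDegree

/-- The tame symbol of `f` and `g` at a point `a`: the value at `t = a` of the rational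
function `(-1) ^ (m_a(f) * m_a(g)) * f ^ (m_a(g)) * g ^ (-m_a(f))`. -/
noncomputable def tameAt {K : Type*} [Field K] (a : K) (f g : RatFunc K) : K :=
  RatFunc.eval (RingHom.id K) a
    ((-1 : RatFunc K) ^ (ordAt a f * ordAt a g) * f ^ (ordAt a g) * g ^ (-(ordAt a f)))

/-- The tame symbol of `f` and `g` at infinity: for the rational function
`c = (-1) ^ (m_∞(f) * m_∞(g)) * f ^ (m_∞(g)) * g ^ (-m_∞(f))`, the ratio of the leading
coefficient of the numerator of `c` to the leading coefficient of its denominator. -/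
noncomputable def tameInf {K : Type*} [Field K] (f g : RatFunc K) : K :=
  ((-1 : RatFunc K) ^ (ordInf f * ordInf g) * f ^ (ordInf g)
      * g ^ (-(ordInf f))).num.leadingCoeff /
    ((-1 : RatFunc K) ^ (ordInf f * ordInf g) * f ^ (ordInf g)
      * g ^ (-(ordInf f))).denom.leadingCoeff

section TameSymbol

open Polynomial nonZeroDivisors

variable {K : Type*} [Field K]

/-- The symbol `(-1) ^ (v f * v g) * L f ^ v g * L g ^ (-v f)` attached to an order function `v`
and a multiplicative leading coefficient map `L`. -/
noncomputable def tameSymbol (v : RatFunc K → ℤ) (L : RatFunc K →*₀ K) (f g : RatFunc K) : K :=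
  (-1) ^ (v f * v g) * L f ^ v g * L g ^ (-v f)

theorem order_one {v : RatFunc K → ℤ}
    (hv : ∀ x y, x ≠ 0 → y ≠ 0 → v (x * y) = v x + v y) : v 1 = 0 := by
  simpa using hv 1 1 one_ne_zero one_ne_zero

theorem order_inv {v : RatFunc K → ℤ}
    (hv : ∀ x y, x ≠ 0 → y ≠ 0 → v (x * y) = v x + v y) {x : RatFunc K} (hx : x ≠ 0) :
    v x⁻¹ = -v x := by
  have h := hv x x⁻¹ hx (inv_ne_zero hx)
  rw [mul_inv_cancel₀ hx, order_one hv] at h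
  linarith

theorem order_zpow {v : RatFunc K → ℤ}
    (hv : ∀ x y, x ≠ 0 → y ≠ 0 → v (x * y) = v x + v y) {x : RatFunc K} (hx : x ≠ 0) (n : ℤ) :
    v (x ^ n) = n * v x := by
  induction n with
  | zero => simp [order_one hv]
  | succ n ih => rw [zpow_add_one₀ hx, hv _ _ (zpow_ne_zero _ hx) hx, ih]; ring
  | pred n ih =>
    rw [zpow_sub_one₀ hx, hv _ _ (zpow_ne_zero _ hx) (inv_ne_zero hx), ih, order_inv hv hx]
    ring

theorem order_neg_one {v : RatFunc K → ℤ}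
    (hv : ∀ x y, x ≠ 0 → y ≠ 0 → v (x * y) = v x + v y) : v (-1) = 0 := by
  have h := hv (-1) (-1) (neg_ne_zero.2 one_ne_zero) (neg_ne_zero.2 one_ne_zero)
  rw [neg_mul_neg, one_mul, order_one hv] at h
  linarith

theorem order_tame_eq_zero {v : RatFunc K → ℤ}
    (hv : ∀ x y, x ≠ 0 → y ≠ 0 → v (x * y) = v x + v y) {f g : RatFunc K}
    (hf : f ≠ 0) (hg : g ≠ 0) :
    v ((-1) ^ (v f * v g) * f ^ v g * g ^ (-v f)) = 0 := by
  have h1 : (-1 : RatFunc K) ≠ 0 := neg_ne_zero.2 one_ne_zero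
  rw [hv _ _ (mul_ne_zero (zpow_ne_zero _ h1) (zpow_ne_zero _ hf)) (zpow_ne_zero _ hg),
    hv _ _ (zpow_ne_zero _ h1) (zpow_ne_zero _ hf), order_zpow hv h1, order_zpow hv hf,
    order_zpow hv hg, order_neg_one hv]
  ring

theorem map_neg_one_eq (L : RatFunc K →*₀ K) (hL : L (RatFunc.C (-1)) = -1) :
    L (-1) = -1 := by
  simpa using hL

theorem map_tame_eq_tameSymbol (v : RatFunc K → ℤ) (L : RatFunc K →*₀ K)
    (hL : L (RatFunc.C (-1)) = -1) (f g : RatFunc K) :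
    L ((-1) ^ (v f * v g) * f ^ v g * g ^ (-v f)) = tameSymbol v L f g := by
  rw [map_mul, map_mul, map_zpow₀, map_zpow₀, map_zpow₀, map_neg_one_eq L hL, tameSymbol]

theorem tameSymbol_ne_zero (v : RatFunc K → ℤ) (L : RatFunc K →*₀ K) {f g : RatFunc K}
    (hf : f ≠ 0) (hg : g ≠ 0) : tameSymbol v L f g ≠ 0 :=
  mul_ne_zero (mul_ne_zero (zpow_ne_zero _ (neg_ne_zero.2 one_ne_zero))
    (zpow_ne_zero _ ((_root_.map_ne_zero L).2 hf))) (zpow_ne_zero _ ((_root_.map_ne_zero L).2 hg))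

theorem tameSymbol_mul_left {v : RatFunc K → ℤ}
    (hv : ∀ x y, x ≠ 0 → y ≠ 0 → v (x * y) = v x + v y) (L : RatFunc K →*₀ K)
    {f₁ f₂ g : RatFunc K} (hf₁ : f₁ ≠ 0) (hf₂ : f₂ ≠ 0) (hg : g ≠ 0) :
    tameSymbol v L (f₁ * f₂) g = tameSymbol v L f₁ g * tameSymbol v L f₂ g := by
  have h1 : (-1 : K) ≠ 0 := neg_ne_zero.2 one_ne_zero
  simp only [tameSymbol]
  rw [hv _ _ hf₁ hf₂, map_mul, add_mul, neg_add, zpow_add₀ h1, mul_zpow,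
    zpow_add₀ ((_root_.map_ne_zero L).2 hg)]
  ring

theorem tameSymbol_symm (v : RatFunc K → ℤ) (L : RatFunc K →*₀ K) (f g : RatFunc K) :
    tameSymbol v L g f = (tameSymbol v L f g)⁻¹ := by
  simp only [tameSymbol, mul_inv, zpow_neg, inv_inv, ← inv_zpow, inv_neg, inv_one, mul_comm (v g)]
  ring

theorem tameSymbol_inv_left {v : RatFunc K → ℤ}
    (hv : ∀ x y, x ≠ 0 → y ≠ 0 → v (x * y) = v x + v y) (L : RatFunc K →*₀ K)
    {f : RatFunc K} (g : RatFunc K) (hf : f ≠ 0) :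
    tameSymbol v L f⁻¹ g = (tameSymbol v L f g)⁻¹ := by
  simp only [tameSymbol, order_inv hv hf, map_inv₀, neg_mul, zpow_neg, inv_zpow, mul_inv]

theorem ordAt_mul (a : K) (x y : RatFunc K) (hx : x ≠ 0) (hy : y ≠ 0) :
    ordAt a (x * y) = ordAt a x + ordAt a y := by
  have hxy := RatFunc.num_ne_zero (mul_ne_zero hx hy)
  have hx' := RatFunc.num_ne_zero hx
  have hy' := RatFunc.num_ne_zero hy
  have h := congrArg (rootMultiplicity a) (RatFunc.num_denom_mul x y)
  rw [rootMultiplicity_mul (mul_ne_zero hxy (mul_ne_zero x.denom_ne_zero y.denom_ne_zero)),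
    rootMultiplicity_mul (mul_ne_zero x.denom_ne_zero y.denom_ne_zero),
    rootMultiplicity_mul (mul_ne_zero (mul_ne_zero hx' hy') (x * y).denom_ne_zero),
    rootMultiplicity_mul (mul_ne_zero hx' hy')] at h
  simp only [ordAt]
  omega

theorem ordInf_mul (x y : RatFunc K) (hx : x ≠ 0) (hy : y ≠ 0) :
    ordInf (x * y) = ordInf x + ordInf y := by
  rw [ordInf, RatFunc.intDegree_mul hx hy, ordInf, ordInf]
  ring

/-- The coefficient of lowest order in the expansion of a polynomial at `a`. -/
noncomputable def polyLeadAt (a : K) : K[X] →*₀ K where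
  toFun p := (taylor a p).trailingCoeff
  map_zero' := by simp
  map_one' := by rw [taylor_one]; simp [trailingCoeff]
  map_mul' p q := by rw [taylor_mul, trailingCoeff_mul]

theorem polyLeadAt_eq_eval {a : K} {p : K[X]} (h : p.eval a ≠ 0) :
    polyLeadAt a p = p.eval a := by
  have h0 : (taylor a p).coeff 0 ≠ 0 := by rwa [taylor_coeff_zero]
  change (taylor a p).coeff (taylor a p).natTrailingDegree = p.eval a
  rw [Nat.le_zero.1 (natTrailingDegree_le_of_ne_zero h0), taylor_coeff_zero]

/-- The leading coefficient of the expansion of a rational function at `a`. -/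
noncomputable def leadAt (a : K) : RatFunc K →*₀ K :=
  RatFunc.liftMonoidWithZeroHom (polyLeadAt a) fun p hp => by
    refine mem_nonZeroDivisors_of_ne_zero (trailingCoeff_nonzero_iff_nonzero.2 ?_)
    exact (taylor_eq_zero a p).not.2 (nonZeroDivisors.ne_zero hp)

/-- The ratio of the leading coefficients of the numerator and denominator. -/
noncomputable def leadInf : RatFunc K →*₀ K :=
  RatFunc.liftMonoidWithZeroHom
    { toFun := leadingCoeff, map_zero' := leadingCoeff_zero, map_one' := leadingCoeff_one,
      map_mul' := leadingCoeff_mul } fun _ hp =>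
    mem_nonZeroDivisors_of_ne_zero (leadingCoeff_ne_zero.2 (nonZeroDivisors.ne_zero hp))

theorem leadAt_apply (a : K) (f : RatFunc K) :
    leadAt a f = polyLeadAt a f.num / polyLeadAt a f.denom :=
  RatFunc.liftMonoidWithZeroHom_apply _ _ _

theorem leadInf_apply (f : RatFunc K) :
    leadInf f = f.num.leadingCoeff / f.denom.leadingCoeff :=
  RatFunc.liftMonoidWithZeroHom_apply _ _ _

theorem eval_eq_leadAt {a : K} {f : RatFunc K} (hf : f ≠ 0) (h : ordAt a f = 0) :
    RatFunc.eval (RingHom.id K) a f = leadAt a f := by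
  have hn := RatFunc.num_ne_zero hf
  have hd := f.denom_ne_zero
  have key : f.num.eval a ≠ 0 ∧ f.denom.eval a ≠ 0 := by
    obtain ⟨u, w, huw⟩ := f.isCoprime_num_denom
    have e := congrArg (Polynomial.eval a) huw
    simp only [eval_add, eval_mul, eval_one] at e
    have hiff : f.num.eval a = 0 ↔ f.denom.eval a = 0 := by
      change f.num.IsRoot a ↔ f.denom.IsRoot a
      rw [← rootMultiplicity_pos hn, ← rootMultiplicity_pos hd]
      simp only [ordAt] at h
      omega
    constructor <;> intro h0
    · simp [h0, hiff.1 h0] at e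
    · simp [h0, hiff.2 h0] at e
  rw [leadAt_apply, polyLeadAt_eq_eval key.1, polyLeadAt_eq_eval key.2, RatFunc.eval,
    ← eval_map, ← eval_map, Polynomial.map_id, Polynomial.map_id]

theorem leadAt_C (a c : K) : leadAt a (RatFunc.C c) = c := by
  by_cases hc : c = 0
  · simp [hc]
  · rw [leadAt_apply, RatFunc.num_C, RatFunc.denom_C, polyLeadAt_eq_eval (by simpa),
      map_one]
    simp

theorem leadInf_C (c : K) : leadInf (RatFunc.C c) = c := by
  rw [leadInf_apply, RatFunc.num_C, RatFunc.denom_C]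
  simp

theorem ordAt_C (a c : K) : ordAt a (RatFunc.C c) = 0 := by
  rw [ordAt, RatFunc.num_C, RatFunc.denom_C, ← Polynomial.C_1, rootMultiplicity_C,
    rootMultiplicity_C]
  simp

theorem ordInf_C (c : K) : ordInf (RatFunc.C c) = 0 := by
  simp [ordInf]

theorem algebraMap_X_sub_C_ne_zero (b : K) :
    algebraMap K[X] (RatFunc K) (X - C b) ≠ 0 :=
  RatFunc.algebraMap_ne_zero (X_sub_C_ne_zero b)

theorem ordAt_X_sub_C_self (b : K) : ordAt b (algebraMap K[X] (RatFunc K) (X - C b)) = 1 := by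
  rw [ordAt, RatFunc.num_algebraMap, RatFunc.denom_algebraMap, rootMultiplicity_X_sub_C_self,
    ← Polynomial.C_1, rootMultiplicity_C]
  simp

theorem ordAt_X_sub_C_of_ne {a b : K} (h : a ≠ b) :
    ordAt a (algebraMap K[X] (RatFunc K) (X - C b)) = 0 := by
  classical
  rw [ordAt, RatFunc.num_algebraMap, RatFunc.denom_algebraMap, rootMultiplicity_X_sub_C,
    if_neg h, ← Polynomial.C_1, rootMultiplicity_C]
  simp

theorem leadAt_X_sub_C_self (b : K) : leadAt b (algebraMap K[X] (RatFunc K) (X - C b)) = 1 := by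
  rw [leadAt_apply, RatFunc.num_algebraMap, RatFunc.denom_algebraMap, map_one, div_one]
  change (taylor b (X - C b)).trailingCoeff = 1
  simp [taylor_X, taylor_C, trailingCoeff]

theorem leadAt_X_sub_C_of_ne {a b : K} (h : a ≠ b) :
    leadAt a (algebraMap K[X] (RatFunc K) (X - C b)) = a - b := by
  rw [leadAt_apply, RatFunc.num_algebraMap, RatFunc.denom_algebraMap, map_one, div_one,
    polyLeadAt_eq_eval] <;> simp [sub_eq_zero, h]

theorem ordInf_X_sub_C (b : K) : ordInf (algebraMap K[X] (RatFunc K) (X - C b)) = -1 := by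
  rw [ordInf, RatFunc.intDegree_polynomial, natDegree_X_sub_C, Nat.cast_one]

theorem leadInf_X_sub_C (b : K) : leadInf (algebraMap K[X] (RatFunc K) (X - C b)) = 1 := by
  rw [leadInf_apply, RatFunc.num_algebraMap, RatFunc.denom_algebraMap, leadingCoeff_X_sub_C]
  simp

theorem tameAt_eq_tameSymbol (a : K) {f g : RatFunc K} (hf : f ≠ 0) (hg : g ≠ 0) :
    tameAt a f g = tameSymbol (ordAt a) (leadAt a) f g := by
  rw [← map_tame_eq_tameSymbol _ _ (leadAt_C a (-1)), tameAt,
    eval_eq_leadAt _ (order_tame_eq_zero (ordAt_mul a) hf hg)]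
  exact mul_ne_zero (mul_ne_zero (zpow_ne_zero _ (neg_ne_zero.2 one_ne_zero))
    (zpow_ne_zero _ hf)) (zpow_ne_zero _ hg)

theorem tameInf_eq_tameSymbol (f g : RatFunc K) :
    tameInf f g = tameSymbol ordInf leadInf f g := by
  rw [← map_tame_eq_tameSymbol _ _ (leadInf_C (-1)), tameInf, leadInf_apply]

/-- The reciprocity relation between the tame symbols of two rational functions. -/
def IsReciprocal (f g : RatFunc K) : Prop :=
  (Function.mulSupport fun a : K => tameSymbol (ordAt a) (leadAt a) f g).Finite ∧
    tameSymbol ordInf leadInf f g * ∏ᶠ a : K, tameSymbol (ordAt a) (leadAt a) f g = 1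

theorem IsReciprocal.symm {f g : RatFunc K} (h : IsReciprocal f g) : IsReciprocal g f := by
  constructor
  · simp_rw [tameSymbol_symm _ _ f g, Function.mulSupport_fun_inv]
    exact h.1
  · simp_rw [tameSymbol_symm _ _ f g, finprod_inv_distrib]
    rw [← mul_inv, h.2, inv_one]

theorem IsReciprocal.inv_left {f g : RatFunc K} (hf : f ≠ 0) (h : IsReciprocal f g) :
    IsReciprocal f⁻¹ g := by
  constructor
  · simp_rw [tameSymbol_inv_left (ordAt_mul _) _ g hf, Function.mulSupport_fun_inv]
    exact h.1
  · simp_rw [tameSymbol_inv_left (ordAt_mul _) _ g hf, tameSymbol_inv_left ordInf_mul _ g hf,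
      finprod_inv_distrib]
    rw [← mul_inv, h.2, inv_one]

theorem IsReciprocal.mul_left {f₁ f₂ g : RatFunc K} (hf₁ : f₁ ≠ 0) (hf₂ : f₂ ≠ 0) (hg : g ≠ 0)
    (h₁ : IsReciprocal f₁ g) (h₂ : IsReciprocal f₂ g) : IsReciprocal (f₁ * f₂) g := by
  constructor
  · simp_rw [tameSymbol_mul_left (ordAt_mul _) _ hf₁ hf₂ hg]
    exact (h₁.1.union h₂.1).subset (Function.mulSupport_mul _ _)
  · simp_rw [tameSymbol_mul_left (ordAt_mul _) _ hf₁ hf₂ hg,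
      tameSymbol_mul_left ordInf_mul _ hf₁ hf₂ hg]
    rw [finprod_mul_distrib h₁.1 h₂.1, mul_mul_mul_comm, h₁.2, h₂.2, one_mul]

theorem isReciprocal_C_C (c d : K) : IsReciprocal (RatFunc.C c) (RatFunc.C d) := by
  constructor <;> simp [tameSymbol, ordAt_C, ordInf_C]

theorem isReciprocal_C_X_sub_C (c b : K) (hc : c ≠ 0) :
    IsReciprocal (RatFunc.C c) (algebraMap K[X] (RatFunc K) (X - C b)) := by
  have hne : ∀ a, a ≠ b → tameSymbol (ordAt a) (leadAt a) (RatFunc.C c)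
      (algebraMap K[X] (RatFunc K) (X - C b)) = 1 := fun a ha => by
    simp [tameSymbol, ordAt_C, ordAt_X_sub_C_of_ne ha, -map_sub]
  constructor
  · exact (Set.finite_singleton b).subset fun a ha => by_contra fun h => ha (hne a h)
  · rw [finprod_eq_single _ b hne]
    simp [tameSymbol, ordAt_C, ordAt_X_sub_C_self, ordInf_C, ordInf_X_sub_C, leadAt_C, leadInf_C,
      hc, -map_sub]

theorem isReciprocal_X_sub_C_self (b : K) :
    IsReciprocal (algebraMap K[X] (RatFunc K) (X - C b))
      (algebraMap K[X] (RatFunc K) (X - C b)) := by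
  have hne : ∀ a, a ≠ b → tameSymbol (ordAt a) (leadAt a)
      (algebraMap K[X] (RatFunc K) (X - C b))
      (algebraMap K[X] (RatFunc K) (X - C b)) = 1 := fun a ha => by
    simp [tameSymbol, ordAt_X_sub_C_of_ne ha, -map_sub]
  constructor
  · exact (Set.finite_singleton b).subset fun a ha => by_contra fun h => ha (hne a h)
  · rw [finprod_eq_single _ b hne]
    simp [tameSymbol, ordAt_X_sub_C_self, ordInf_X_sub_C, leadAt_X_sub_C_self, leadInf_X_sub_C,
      -map_sub]

theorem isReciprocal_X_sub_C_of_ne {b c : K} (hbc : b ≠ c) :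
    IsReciprocal (algebraMap K[X] (RatFunc K) (X - C b))
      (algebraMap K[X] (RatFunc K) (X - C c)) := by
  classical
  have hsub : (Function.mulSupport fun a : K => tameSymbol (ordAt a) (leadAt a)
      (algebraMap K[X] (RatFunc K) (X - C b))
      (algebraMap K[X] (RatFunc K) (X - C c))) ⊆ ({b, c} : Finset K) := fun a ha => by
    by_contra h
    simp only [Finset.coe_insert, Finset.coe_singleton, Set.mem_insert_iff,
      Set.mem_singleton_iff, not_or] at h
    refine ha ?_
    simp [tameSymbol, ordAt_X_sub_C_of_ne h.1, ordAt_X_sub_C_of_ne h.2, -map_sub]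
  constructor
  · exact (Finset.finite_toSet _).subset hsub
  · rw [finprod_eq_prod_of_mulSupport_subset _ hsub, Finset.prod_pair hbc]
    have hb : b - c ≠ 0 := sub_ne_zero.2 hbc
    simp only [tameSymbol, ordAt_X_sub_C_self, ordAt_X_sub_C_of_ne hbc,
      ordAt_X_sub_C_of_ne hbc.symm, ordInf_X_sub_C, leadInf_X_sub_C,
      leadAt_X_sub_C_of_ne hbc, leadAt_X_sub_C_of_ne hbc.symm]
    simp
    field_simp
    ring

/-- Over an algebraically closed field, a property of nonzero rational functions can be checked
on constants and linear polynomials if it is stable under products and inverses. -/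
theorem RatFunc.induction_on_linear [IsAlgClosed K] {P : RatFunc K → Prop}
    (hC : ∀ c : K, c ≠ 0 → P (RatFunc.C c))
    (hX : ∀ b : K, P (algebraMap K[X] (RatFunc K) (Polynomial.X - Polynomial.C b)))
    (hmul : ∀ x y, x ≠ 0 → y ≠ 0 → P x → P y → P (x * y))
    (hinv : ∀ x, x ≠ 0 → P x → P x⁻¹) {f : RatFunc K} (hf : f ≠ 0) : P f := by
  have hprod : ∀ s : Multiset K, P (algebraMap K[X] (RatFunc K)
      (s.map fun b => Polynomial.X - Polynomial.C b).prod) := fun s => by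
    induction s using Multiset.induction_on with
    | empty => simpa using hC 1 one_ne_zero
    | cons b s ih =>
      rw [Multiset.map_cons, Multiset.prod_cons, map_mul]
      exact hmul _ _ (algebraMap_X_sub_C_ne_zero b) (RatFunc.algebraMap_ne_zero
        (monic_multisetProd_X_sub_C s).ne_zero) (hX b) ih
  have hpoly : ∀ p : K[X], p ≠ 0 → P (algebraMap K[X] (RatFunc K) p) := fun p hp => by
    have hlc := leadingCoeff_ne_zero.2 hp
    rw [(IsAlgClosed.splits p).eq_prod_roots, map_mul, RatFunc.algebraMap_C]
    exact hmul _ _ ((_root_.map_ne_zero _).2 hlc) (RatFunc.algebraMap_ne_zero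
      (monic_multisetProd_X_sub_C p.roots).ne_zero) (hC _ hlc) (hprod _)
  rw [← RatFunc.num_div_denom f, div_eq_mul_inv]
  have hn := RatFunc.num_ne_zero hf
  have hd := f.denom_ne_zero
  exact hmul _ _ (RatFunc.algebraMap_ne_zero hn) (inv_ne_zero (RatFunc.algebraMap_ne_zero hd))
    (hpoly _ hn) (hinv _ (RatFunc.algebraMap_ne_zero hd) (hpoly _ hd))

theorem isReciprocal_of_ne_zero [IsAlgClosed K] {f g : RatFunc K} (hf : f ≠ 0) (hg : g ≠ 0) :
    IsReciprocal f g := by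
  have of_left : ∀ g : RatFunc K, g ≠ 0 → (∀ c : K, c ≠ 0 → IsReciprocal (RatFunc.C c) g) →
      (∀ b : K, IsReciprocal (algebraMap K[X] (RatFunc K) (X - C b)) g) →
      ∀ f : RatFunc K, f ≠ 0 → IsReciprocal f g := fun g hg hC hX f hf =>
    RatFunc.induction_on_linear (P := fun f => IsReciprocal f g) hC hX
      (fun _ _ hx hy => IsReciprocal.mul_left hx hy hg) (fun _ hx => IsReciprocal.inv_left hx) hf
  refine of_left g hg (fun c hc => ?_) (fun b => ?_) f hf
  · exact (of_left _ ((_root_.map_ne_zero RatFunc.C).2 hc) (fun d _ => isReciprocal_C_C d c)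
      (fun b => (isReciprocal_C_X_sub_C c b hc).symm) g hg).symm
  · refine (of_left _ (algebraMap_X_sub_C_ne_zero b) (fun d hd => isReciprocal_C_X_sub_C d b hd)
      (fun c => ?_) g hg).symm
    rcases eq_or_ne c b with rfl | h
    · exact isReciprocal_X_sub_C_self c
    · exact isReciprocal_X_sub_C_of_ne h

end TameSymbol

/-- **Weil reciprocity law.** Let `K` be an algebraically closed field of characteristic
zero and `f, g` nonzero rational functions over `K`. Then for each `a ∈ K` the rational
function `(-1) ^ (m_a(f)m_a(g)) f^(m_a(g)) g^(-m_a(f))` has order `0` at `a` and its value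
`T_a(f,g)` at `a` is nonzero; the analogous statement holds at infinity; `T_a(f,g) = 1` for
all but finitely many `a`; and `T_∞(f,g) * ∏_a T_a(f,g) = 1`. -/
theorem weil_reciprocity {K : Type*} [Field K] [IsAlgClosed K] [CharZero K]
    (f g : RatFunc K) (hf : f ≠ 0) (hg : g ≠ 0) :
    (∀ a : K, ordAt a ((-1 : RatFunc K) ^ (ordAt a f * ordAt a g) * f ^ (ordAt a g)
        * g ^ (-(ordAt a f))) = 0 ∧ tameAt a f g ≠ 0) ∧
    ordInf ((-1 : RatFunc K) ^ (ordInf f * ordInf g) * f ^ (ordInf g)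
        * g ^ (-(ordInf f))) = 0 ∧ tameInf f g ≠ 0 ∧
    (Function.mulSupport (fun a : K => tameAt a f g)).Finite ∧
    tameInf f g * ∏ᶠ a : K, tameAt a f g = 1 := by
  have hT : (fun a : K => tameAt a f g) = fun a => tameSymbol (ordAt a) (leadAt a) f g :=
    funext fun a => tameAt_eq_tameSymbol a hf hg
  have h := isReciprocal_of_ne_zero hf hg
  refine ⟨fun a => ⟨order_tame_eq_zero (ordAt_mul a) hf hg, ?_⟩,
    order_tame_eq_zero ordInf_mul hf hg, ?_, ?_, ?_⟩
  · rw [tameAt_eq_tameSymbol a hf hg]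
    exact tameSymbol_ne_zero _ _ hf hg
  · rw [tameInf_eq_tameSymbol]
    exact tameSymbol_ne_zero _ _ hf hg
  · rw [hT]
    exact h.1
  · rw [hT, tameInf_eq_tameSymbol]
    exact h.2
end
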